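/- There exists a constant c_n > 0, depending only on n, such that for any ℂ-convex domain D ⊆ ℂ^n containing no complex affine line, any z ∈ D and any nonzero X ∈ ℂ^n, one has B_D(z;X)·d_D(z,X) ≤ c_n. -/

import Mathlib

open Complex Metric Set MeasureTheory

noncomputable section

/-- `ℂ^n` with the Euclidean (Hermitian) structure. -/
abbrev Cn (n : ℕ) := EuclideanSpace ℂ (Fin n)

instance (n : ℕ) : MeasurableSpace (Cn n) := borel _
instance (n : ℕ) : BorelSpace (Cn n) := ⟨rfl⟩

/-- The complex affine line through `z` in direction `X`. -/
def cline {n : ℕ} (z X : Cn n) : Set (Cn n) := {w | ∃ l : ℂ, w = z + l • X}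

/-- A domain: a nonempty connected open set. -/
def IsDomain' {n : ℕ} (D : Set (Cn n)) : Prop := IsOpen D ∧ IsConnected D

/-- `D` is ℂ-convex: its intersection with every complex affine line is, when
nonempty, connected and simply connected. -/
def IsCConvex {n : ℕ} (D : Set (Cn n)) : Prop :=
  ∀ z X : Cn n, X ≠ 0 → (D ∩ cline z X).Nonempty →
    IsConnected (D ∩ cline z X) ∧ SimplyConnectedSpace ↥(D ∩ cline z X)

/-- The Carathéodory metric `γ_D(z;X)`. -/
def caraMetric {n : ℕ} (D : Set (Cn n)) (z X : Cn n) : ℝ :=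
  sSup {r : ℝ | ∃ f : Cn n → ℂ, DifferentiableOn ℂ f D ∧ MapsTo f D (ball (0:ℂ) 1) ∧
    f z = 0 ∧ r = ‖fderiv ℂ f z X‖}

/-- The Kobayashi metric `κ_D(z;X)`. -/
def kobMetric {n : ℕ} (D : Set (Cn n)) (z X : Cn n) : ℝ :=
  sInf {a : ℝ | 0 ≤ a ∧ ∃ φ : ℂ → Cn n, DifferentiableOn ℂ φ (ball (0:ℂ) 1) ∧
    MapsTo φ (ball (0:ℂ) 1) D ∧ φ 0 = z ∧ a • (fderiv ℂ φ 0 1) = X}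

/-- The distance `d_D(z,X)` from `z` to `∂D` in direction `X`. -/
def dirDist {n : ℕ} (D : Set (Cn n)) (z X : Cn n) : ℝ :=
  sSup {r : ℝ | 0 < r ∧ ∀ l : ℂ, ‖l‖ < r → z + l • X ∈ D}

/-- The Euclidean distance `d_D(z)` from `z` to `∂D`. -/
def bdist {n : ℕ} (D : Set (Cn n)) (z : Cn n) : ℝ := Metric.infDist z (frontier D)

/-- `L_a`: the set of vectors `X` such that a disc `{a + λX : |λ| < ε}` lies in `∂D`. -/
def La {n : ℕ} (D : Set (Cn n)) (a : Cn n) : Set (Cn n) :=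
  {X | ∃ ε > (0:ℝ), ∀ l : ℂ, ‖l‖ < ε → a + l • X ∈ frontier D}

/-- `D` contains no complex affine line. -/
def NoComplexLine {n : ℕ} (D : Set (Cn n)) : Prop :=
  ¬ ∃ z X : Cn n, X ≠ 0 ∧ cline z X ⊆ D

/-- The Bergman kernel `K_D(z)` (restricted to the diagonal). -/
def bergmanKernel {n : ℕ} (D : Set (Cn n)) (z : Cn n) : ℝ :=
  sSup {r : ℝ | ∃ f : Cn n → ℂ, DifferentiableOn ℂ f D ∧
    IntegrableOn (fun w => ‖f w‖ ^ 2) D ∧ (∫ w in D, ‖f w‖ ^ 2) ≤ 1 ∧ r = ‖f z‖ ^ 2}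

/-- `M_D(z;X)`. -/
def bergmanM {n : ℕ} (D : Set (Cn n)) (z X : Cn n) : ℝ :=
  sSup {r : ℝ | ∃ f : Cn n → ℂ, DifferentiableOn ℂ f D ∧
    IntegrableOn (fun w => ‖f w‖ ^ 2) D ∧ (∫ w in D, ‖f w‖ ^ 2) = 1 ∧
    f z = 0 ∧ r = ‖fderiv ℂ f z X‖}

/-- The Bergman metric `B_D(z;X) = M_D(z;X)/√K_D(z)`. -/
def bergmanMetric {n : ℕ} (D : Set (Cn n)) (z X : Cn n) : ℝ :=
  bergmanM D z X / Real.sqrt (bergmanKernel D z)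

/-- `G` is weakly linearly convex: through every boundary point there is a complex
affine hyperplane missing `G`. -/
def WeaklyLinConvex {n : ℕ} (G : Set (Cn n)) : Prop :=
  ∀ a ∈ frontier G, ∃ ℓ : Cn n →L[ℂ] ℂ, ℓ ≠ 0 ∧ ∀ z ∈ G, ℓ z ≠ ℓ a

/-- `d_{j,D}(z)` from the minimal-distance construction: the distance from `z` to the
boundary of the slice of `D` by the affine subspace `z + span{v_i : i ≥ j}`. -/
def sliceDist {n : ℕ} (D : Set (Cn n)) (z : Cn n) (v : Fin n → Cn n) (j : Fin n) : ℝ :=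
  sSup {r : ℝ | 0 < r ∧
    ∀ w ∈ Submodule.span ℂ (v '' {i | j ≤ i}), ‖w‖ < r → z + w ∈ D}

/-- The data `(v j)` is an admissible output of the minimal-distance construction at `z`:
the directions are orthonormal and each `v j` realizes the distance `d_{j,D}(z)` to the
boundary of the corresponding slice. -/
def MinimalBasis {n : ℕ} (D : Set (Cn n)) (z : Cn n) (v : Fin n → Cn n) : Prop :=
  Orthonormal ℂ v ∧ ∀ j : Fin n, z + (sliceDist D z v j) • v j ∉ D


open Topology
lemma isSimplyConnected_univ_complex : IsSimplyConnected (univ : Set ℂ) := by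
  have : ContractibleSpace (univ : Set ℂ) := convex_univ.contractibleSpace univ_nonempty
  exact (inferInstance : SimplyConnectedSpace (univ : Set ℂ))

/-- Two continuous logarithms of a function on a preconnected set differ by a constant. -/
lemma sub_eq_sub_of_exp_eq {A : Type*} [TopologicalSpace A] {S : Set A} (hS : IsPreconnected S)
    {g h : A → ℂ} (hg : ContinuousOn g S) (hh : ContinuousOn h S)
    (hexp : ∀ a ∈ S, ∀ b ∈ S, exp (g a - h a) = exp (g b - h b)) {a b : A} (ha : a ∈ S)
    (hb : b ∈ S) : g a - h a = g b - h b :=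
  Complex.isCoveringMap_exp.constOn_of_comp hS (hg.sub hh)
    (fun x hx y hy => Subtype.ext (hexp x hx y hy)) ha hb

/-- If a fibrewise continuous logarithm `g` of `φ` over a parameter space depends continuously on
the parameter along one local section through `(t₀, s t₀)`, then it is jointly continuous at every
point of the (connected) fibre over `t₀`. -/
lemma continuousAt_of_fiberwise_log {T : Type*} [TopologicalSpace T] {W : Set (T × ℂ)}
    (hW : IsOpen W) {φ g : T × ℂ → ℂ} (hφ : ContinuousOn φ W)
    (hexp : ∀ p ∈ W, exp (g p) = φ p) {t₀ : T} (hcon : IsPreconnected {x | (t₀, x) ∈ W})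
    (hfib : ∀ t, ContinuousOn (fun x => g (t, x)) {x | (t, x) ∈ W}) {s : T → ℂ}
    (hs : ContinuousAt s t₀) (hs₀ : (t₀, s t₀) ∈ W)
    (hgs : ContinuousAt (fun t => g (t, s t)) t₀) {x : ℂ} (hx : (t₀, x) ∈ W) :
    ContinuousAt g (t₀, x) := by
  have key : ∀ x₁, (t₀, x₁) ∈ W → ∃ r > 0, (∀ y ∈ ball x₁ r, (t₀, y) ∈ W) ∧
      ∀ s' : T → ℂ, ContinuousAt s' t₀ →
      s' t₀ ∈ ball x₁ r → ContinuousAt (fun t => g (t, s' t)) t₀ →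
      ∀ y ∈ ball x₁ r, ContinuousAt g (t₀, y) := by
    intro x₁ hx₁
    have hne : φ (t₀, x₁) ≠ 0 := by rw [← hexp _ hx₁]; exact exp_ne_zero _
    have hφ₁ : ContinuousAt (fun p => φ p / φ (t₀, x₁)) (t₀, x₁) :=
      (hφ.continuousAt (hW.mem_nhds hx₁)).div_const _
    have hmem : {p | p ∈ W ∧ φ p / φ (t₀, x₁) ∈ slitPlane} ∈ 𝓝 (t₀, x₁) := by
      refine Filter.inter_mem (hW.mem_nhds hx₁) (hφ₁ (isOpen_slitPlane.mem_nhds ?_))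
      simp [div_self hne]
    rw [nhds_prod_eq] at hmem
    obtain ⟨N, hN, B, hB, hNB⟩ := Filter.mem_prod_iff.1 hmem
    obtain ⟨r, hr, hrB⟩ := Metric.mem_nhds_iff.1 hB
    have hsub : ∀ t ∈ N, ∀ y ∈ ball x₁ r, (t, y) ∈ W ∧ φ (t, y) / φ (t₀, x₁) ∈ slitPlane :=
      fun t ht y hy => hNB (mk_mem_prod ht (hrB hy))
    have ht₀ : t₀ ∈ N := mem_of_mem_nhds hN
    refine ⟨r, hr, fun y hy => (hsub _ ht₀ y hy).1, ?_⟩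
    intro s' hs' hs'₀ hgs' y hy
    set ℓ : T × ℂ → ℂ := fun p => log (φ p / φ (t₀, x₁)) with hℓ
    have hℓc : ∀ t ∈ N, ∀ y ∈ ball x₁ r, ContinuousAt ℓ (t, y) := fun t ht y hy =>
      ((hφ.continuousAt (hW.mem_nhds (hsub t ht y hy).1)).div_const _).clog (hsub t ht y hy).2
    have hconst : ∀ t ∈ N, ∀ y ∈ ball x₁ r, ∀ y' ∈ ball x₁ r,
        g (t, y) - ℓ (t, y) = g (t, y') - ℓ (t, y') := by
      intro t ht y hy y' hy'
      refine sub_eq_sub_of_exp_eq (S := ball x₁ r) (g := fun y => g (t, y))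
        (h := fun y => ℓ (t, y)) (convex_ball _ _).isPreconnected
        ((hfib t).mono fun y hy => (hsub t ht y hy).1) ?_ ?_ hy hy'
      · intro y hy
        exact ((hℓc t ht y hy).comp (f := fun y => (t, y)) (by fun_prop)).continuousWithinAt
      · have : ∀ y ∈ ball x₁ r, exp (g (t, y) - ℓ (t, y)) = φ (t₀, x₁) := by
          intro y hy
          have h1 : φ (t, y) ≠ 0 := by rw [← hexp _ (hsub t ht y hy).1]; exact exp_ne_zero _
          rw [exp_sub, hexp _ (hsub t ht y hy).1, hℓ]
          simp only
          rw [exp_log (div_ne_zero h1 hne)]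
          field_simp
        intro a ha b hb
        rw [this a ha, this b hb]
    have hev : (fun p : T × ℂ => g (p.1, s' p.1) - ℓ (p.1, s' p.1) + ℓ p) =ᶠ[𝓝 (t₀, y)] g := by
      have h1 : ∀ᶠ p : T × ℂ in 𝓝 (t₀, y), p.1 ∈ N := continuousAt_fst.eventually_mem hN
      have h2 : ∀ᶠ p : T × ℂ in 𝓝 (t₀, y), p.2 ∈ ball x₁ r :=
        continuousAt_snd.eventually_mem (isOpen_ball.mem_nhds hy)
      have h3 : ∀ᶠ p : T × ℂ in 𝓝 (t₀, y), s' p.1 ∈ ball x₁ r :=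
        (hs'.comp (x := ((t₀, y) : T × ℂ)) continuousAt_fst).eventually_mem
          (isOpen_ball.mem_nhds hs'₀)
      filter_upwards [h1, h2, h3] with p hp1 hp2 hp3
      rw [hconst _ hp1 _ hp3 _ hp2]
      simp
    refine ContinuousAt.congr ?_ hev
    have h1 : ContinuousAt (fun p : T × ℂ => g (p.1, s' p.1)) (t₀, y) :=
      hgs'.comp (x := ((t₀, y) : T × ℂ)) (f := Prod.fst) continuousAt_fst
    have h2 : ContinuousAt (fun t => ℓ (t, s' t)) t₀ :=
      (hℓc t₀ ht₀ _ hs'₀).comp (f := fun t => (t, s' t)) (continuousAt_id.prodMk hs')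
    have h3 : ContinuousAt (fun p : T × ℂ => ℓ (p.1, s' p.1)) (t₀, y) :=
      h2.comp (x := ((t₀, y) : T × ℂ)) (f := Prod.fst) continuousAt_fst
    exact (h1.sub h3).add (hℓc t₀ ht₀ y hy)
  have keyQ : ∀ x₁, (t₀, x₁) ∈ W → ∃ r > 0, (∀ y ∈ ball x₁ r, (t₀, y) ∈ W) ∧
      ∀ y ∈ ball x₁ r, ∀ y' ∈ ball x₁ r, ContinuousAt g (t₀, y) → ContinuousAt g (t₀, y') := by
    intro x₁ hx₁
    obtain ⟨r, hr, hrW, h⟩ := key x₁ hx₁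
    refine ⟨r, hr, hrW, fun y hy y' hy' hc => h (fun _ => y) continuousAt_const hy ?_ y' hy'⟩
    exact hc.comp (f := fun t => (t, y)) (by fun_prop)
  by_contra hnot
  have hopen : ∀ P : Prop → Prop, IsOpen {y | (t₀, y) ∈ W ∧ P (ContinuousAt g (t₀, y))} := by
    intro P
    rw [Metric.isOpen_iff]
    rintro y ⟨hy, hyc⟩
    obtain ⟨r, hr, hrW, h⟩ := keyQ y hy
    refine ⟨r, hr, fun y' hy' => ⟨hrW y' hy', ?_⟩⟩
    have : ContinuousAt g (t₀, y) ↔ ContinuousAt g (t₀, y') :=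
      ⟨h _ (mem_ball_self hr) _ hy', h _ hy' _ (mem_ball_self hr)⟩
    rwa [← this]
  obtain ⟨y, hy, ⟨_, h1⟩, ⟨_, h2⟩⟩ := hcon _ _ (hopen id) (hopen Not)
    (fun y hy => by by_cases h : ContinuousAt g (t₀, y) <;> simp_all)
    ⟨s t₀, hs₀, hs₀, by
      obtain ⟨r, hr, hrW, h⟩ := key _ hs₀
      exact h s hs (mem_ball_self hr) hgs _ (mem_ball_self hr)⟩ ⟨x, hx, hx, hnot⟩
  exact h2 h1

lemma exists_log_of_fiberwise {W : Set (ℂ × ℂ)} (hW : IsOpen W) {φ : ℂ × ℂ → ℂ}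
    (hφ : ContinuousOn φ W) (hne : ∀ t, ∃ x, (t, x) ∈ W)
    (hcon : ∀ t, IsPreconnected {x | (t, x) ∈ W})
    (hlog : ∀ t, ∃ g : ℂ → ℂ, ContinuousOn g {x | (t, x) ∈ W} ∧
      ∀ x, (t, x) ∈ W → exp (g x) = φ (t, x)) :
    ∃ g : ℂ × ℂ → ℂ, ContinuousOn g W ∧ ∀ p ∈ W, exp (g p) = φ p := by
  choose g₀ hg₀c hg₀ using hlog
  set g : ℂ × ℂ → ℂ := fun p => g₀ p.1 p.2 with hg
  have hgexp : ∀ p ∈ W, exp (g p) = φ p := fun p hp => hg₀ p.1 p.2 hp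
  choose ξ hξ using hne
  set U : ℂ → Set ℂ := fun i => {t | (t, ξ i) ∈ W} with hU
  have hUo : ∀ i, IsOpen (U i) := fun i => hW.preimage (by fun_prop)
  have hdiff : ∀ i t x, t ∈ U i → (t, x) ∈ W →
      ContinuousAt (fun p : ℂ × ℂ => g p - g (p.1, ξ i)) (t, x) := by
    intro i t x ht hx
    set W' : Set (ℂ × ℂ) := W ∩ {p | p.1 ∈ U i}
    have hW' : IsOpen W' := hW.inter ((hUo i).preimage continuous_fst)
    have hfst : ContinuousOn (fun p : ℂ × ℂ => φ (p.1, ξ i)) W' :=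
      hφ.comp (by fun_prop) fun p hp => hp.2
    refine continuousAt_of_fiberwise_log (W := W') hW' (t₀ := t)
      (φ := fun p => φ p / φ (p.1, ξ i)) ?_ ?_ ?_ ?_
      (s := fun _ => ξ i) continuousAt_const ⟨ht, ht⟩ ?_ ⟨hx, ht⟩
    · refine (hφ.mono inter_subset_left).div hfst fun p hp => ?_
      rw [← hgexp _ hp.2]; exact exp_ne_zero _
    · rintro p ⟨hp, hp'⟩
      rw [exp_sub, hgexp _ hp, hgexp _ hp']
    · convert hcon t using 1
      ext y
      exact ⟨fun h => h.1, fun h => ⟨h, ht⟩⟩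
    · intro t'
      exact ((hg₀c t').mono fun y hy => hy.1).sub (continuousOn_const (c := g (t', ξ i)))
    · simpa using continuousAt_const
  obtain ⟨ρ, hρ⟩ := PartitionOfUnity.exists_isSubordinate (s := (univ : Set ℂ)) isClosed_univ U hUo
    fun t _ => mem_iUnion.2 ⟨t, hξ t⟩
  set c : ℂ → ℂ := fun t => ∑ i ∈ ρ.finsupport t, (ρ i t : ℂ) * g (t, ξ i) with hc
  have hG : ContinuousOn (fun p : ℂ × ℂ => g p - c p.1) W := by
    rintro ⟨t₀, x₀⟩ h₀
    refine ContinuousAt.continuousWithinAt ?_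
    have hev : (fun p : ℂ × ℂ => ∑ i ∈ ρ.fintsupport t₀, (ρ i p.1 : ℂ) * (g p - g (p.1, ξ i)))
        =ᶠ[𝓝 (t₀, x₀)] fun p => g p - c p.1 := by
      have h1 : ∀ᶠ p : ℂ × ℂ in 𝓝 (t₀, x₀), ρ.finsupport p.1 ⊆ ρ.fintsupport t₀ :=
        (continuousAt_fst (p := ((t₀, x₀) : ℂ × ℂ))).eventually (ρ.eventually_finsupport_subset t₀)
      filter_upwards [h1] with p hp
      have hsum : ∑ i ∈ ρ.fintsupport t₀, (ρ i p.1 : ℂ) = 1 := by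
        have := ρ.sum_finsupport' (mem_univ p.1) hp
        exact_mod_cast this
      simp only [mul_sub, Finset.sum_sub_distrib, ← Finset.sum_mul, hsum, one_mul, hc]
      congr 1
      symm
      refine Finset.sum_subset hp fun i _ hi => ?_
      rw [PartitionOfUnity.mem_finsupport, Function.notMem_support] at hi
      simp [hi]
    refine ContinuousAt.congr ?_ hev
    refine tendsto_finsetSum _ fun i hi => ?_
    refine ContinuousAt.mul ?_ (hdiff i t₀ x₀ ?_ h₀)
    · have := (ρ i).continuous
      fun_prop
    · exact hρ i ((PartitionOfUnity.mem_fintsupport_iff _ _ _).1 hi)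
  have hcexp : Continuous fun t => exp (c t) := by
    rw [continuous_iff_continuousAt]
    intro t₀
    have hmem : ∀ᶠ t in 𝓝 t₀, (t, ξ t₀) ∈ W := (hUo t₀).mem_nhds (hξ t₀)
    have hev : (fun t => φ (t, ξ t₀) / exp (g (t, ξ t₀) - c t)) =ᶠ[𝓝 t₀] fun t => exp (c t) := by
      filter_upwards [hmem] with t ht
      rw [← hgexp _ ht, ← exp_sub]
      congr 1; ring
    refine ContinuousAt.congr ?_ hev
    have hcurve : ContinuousAt (fun t : ℂ => (t, ξ t₀)) t₀ := by fun_prop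
    refine ContinuousAt.div ?_ ?_ (exp_ne_zero _)
    · exact (hφ.continuousAt (hW.mem_nhds (hξ t₀))).comp (f := fun t : ℂ => (t, ξ t₀)) hcurve
    · exact ((hG.continuousAt (hW.mem_nhds (hξ t₀))).comp (f := fun t : ℂ => (t, ξ t₀)) hcurve).cexp
  obtain ⟨C, hCc, hC⟩ := Complex.exists_continuousOn_eqOn_exp_comp (U := (univ : Set ℂ))
    isSimplyConnected_univ_complex isOpen_univ hcexp.continuousOn
    (by rintro ⟨t, -, ht⟩; exact exp_ne_zero _ ht)
  refine ⟨fun p => g p - c p.1 + C p.1, hG.add ?_, fun p hp => ?_⟩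
  · exact (continuousOn_univ.1 hCc |>.comp continuous_fst).continuousOn
  · have : exp (C p.1) = exp (c p.1) := hC (mem_univ p.1)
    rw [exp_add, this, ← exp_add, sub_add_cancel, hgexp p hp]
/-- A subset of a complex vector space whose slices by complex affine lines are connected and carry
a continuous logarithm of every nonvanishing affine function. -/
def LogConvex {V : Type*} [NormedAddCommGroup V] [NormedSpace ℂ V] (E : Set V) : Prop :=
  ∀ p ∈ E, ∀ v : V, v ≠ 0 → IsPreconnected {l : ℂ | p + l • v ∈ E} ∧
    ∀ α β : ℂ, (∀ l : ℂ, p + l • v ∈ E → α + β * l ≠ 0) →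
      ∃ g : ℂ → ℂ, ContinuousOn g {l : ℂ | p + l • v ∈ E} ∧
        ∀ l : ℂ, p + l • v ∈ E → exp (g l) = α + β * l

section LogConvex

variable {V : Type*} [NormedAddCommGroup V] [NormedSpace ℂ V] {E : Set V}

lemma LogConvex.preimage {V' : Type*} [NormedAddCommGroup V'] [NormedSpace ℂ V']
    (hE : LogConvex E) (a : V) (f : V' →ₗ[ℂ] V) (hf : Function.Injective f) :
    LogConvex {x | a + f x ∈ E} := by
  intro p hp v hv
  have h := hE _ hp (f v) (fun h => hv (hf (by simpa using h)))
  have e : ∀ l : ℂ, a + f (p + l • v) = a + f p + l • f v := fun l => by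
    rw [map_add, map_smul, add_assoc]
  simpa only [mem_ofPred_eq, e] using h

lemma LogConvex.isPreconnected_inter (hE : LogConvex E) (ℓ : V →L[ℂ] ℂ) (x : ℂ) :
    IsPreconnected {w | w ∈ E ∧ ℓ w = x} := by
  refine isPreconnected_of_forall_pair fun p hp q hq => ?_
  obtain rfl | hne := eq_or_ne q p
  · exact ⟨{q}, by simpa using hp, rfl, rfl, isPreconnected_singleton⟩
  refine ⟨(fun l : ℂ => p + l • (q - p)) '' {l | p + l • (q - p) ∈ E}, ?_, ⟨0, ?_, ?_⟩,
    ⟨1, ?_, ?_⟩, ?_⟩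
  · rintro _ ⟨l, hl, rfl⟩
    exact ⟨hl, by simp [hp.2, hq.2]⟩
  · simpa using hp.1
  · simp
  · simpa using hq.1
  · simp
  · exact (hE p hp.1 (q - p) (sub_ne_zero.2 hne)).1.image _ (by fun_prop)

lemma LogConvex.isPreconnected (hE : LogConvex E) : IsPreconnected E := by
  simpa using hE.isPreconnected_inter 0 0

lemma LogConvex.exists_log_sub (hE : LogConvex E) (hEo : IsOpen E) {p : V} (hp : p ∈ E)
    (ℓ : V →L[ℂ] ℂ) {c : ℂ} (hc : ∀ w ∈ E, ℓ w ≠ c) :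
    ∃ G : V → ℂ, ContinuousOn G E ∧ ∀ w ∈ E, exp (G w) = ℓ w - c := by
  have hφ : ∀ (w : V) (l : ℂ), (ℓ p - c) + ℓ (w - p) * l = ℓ (p + l • (w - p)) - c := by
    intro w l
    simp only [map_add, map_smul, smul_eq_mul]
    ring
  have hloc : ∀ w : V, ∃ g : ℂ → ℂ, ContinuousOn g {l : ℂ | p + l • (w - p) ∈ E} ∧
      (∀ l : ℂ, p + l • (w - p) ∈ E → exp (g l) = (ℓ p - c) + ℓ (w - p) * l) ∧
      g 0 = log (ℓ p - c) := by
    intro w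
    obtain rfl | hne := eq_or_ne w p
    · refine ⟨fun _ => log (ℓ w - c), continuousOn_const, fun l _ => ?_, rfl⟩
      rw [exp_log (sub_ne_zero.2 (hc w hp))]
      simp
    · obtain ⟨g, hgc, hg⟩ := (hE p hp (w - p) (sub_ne_zero.2 hne)).2 (ℓ p - c) (ℓ (w - p))
        fun l hl => by rw [hφ]; exact sub_ne_zero.2 (hc _ hl)
      refine ⟨fun l => g l - g 0 + log (ℓ p - c), (hgc.sub continuousOn_const).add
        continuousOn_const, fun l hl => ?_, by simp⟩
      have h0 := hg 0 (by simpa using hp)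
      rw [exp_add, exp_sub, hg l hl, h0, exp_log (sub_ne_zero.2 (hc _ hp)), mul_zero, add_zero,
        div_mul_cancel₀ _ (sub_ne_zero.2 (hc _ hp))]
  choose g hgc hg hg0 using hloc
  have hWo : IsOpen {q : V × ℂ | p + q.2 • (q.1 - p) ∈ E} := hEo.preimage (by fun_prop)
  refine ⟨fun w => g w 1, fun w hw => ContinuousAt.continuousWithinAt ?_, fun w hw => ?_⟩
  · have h := continuousAt_of_fiberwise_log hWo (g := fun q => g q.1 q.2)
      (φ := fun q => (ℓ p - c) + ℓ (q.1 - p) * q.2) (by fun_prop) (fun q hq => hg _ _ hq)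
      (t₀ := w) ?_ hgc (s := fun _ => 0) continuousAt_const (by simpa using hp)
      (by simpa only [hg0] using continuousAt_const) (x := 1) (by simpa using hw)
    · exact h.comp (f := fun w => (w, (1 : ℂ))) (by fun_prop)
    · obtain rfl | hne := eq_or_ne w p
      · simpa [hp] using isPreconnected_univ
      · exact (hE p hp (w - p) (sub_ne_zero.2 hne)).1
  · rw [hg w 1 (by simpa using hw), hφ]
    simp

/-- The image of a nonempty open `LogConvex` set under a nonzero linear functional carries a
continuous logarithm of `x - c` for every omitted value `c`. -/
lemma LogConvex.exists_log_image (hE : LogConvex E) (hEo : IsOpen E) (hne : E.Nonempty)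
    (ℓ : V →L[ℂ] ℂ) {v : V} (hv : ℓ v = 1) {c : ℂ} (hc : ∀ w ∈ E, ℓ w ≠ c) :
    ∃ g : ℂ → ℂ, ContinuousOn g (ℓ '' E) ∧ ∀ x ∈ ℓ '' E, exp (g x) = x - c := by
  obtain ⟨p, hp⟩ := hne
  obtain ⟨G, hGc, hG⟩ := hE.exists_log_sub hEo hp ℓ hc
  have hfib : ∀ w ∈ E, ∀ w' ∈ E, ℓ w = ℓ w' → G w = G w' := by
    intro w hw w' hw' h
    have := sub_eq_sub_of_exp_eq (hE.isPreconnected_inter ℓ (ℓ w')) (g := G) (h := fun _ => 0)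
      (hGc.mono fun x hx => hx.1) continuousOn_const
      (fun a ha b hb => by simp [hG a ha.1, hG b hb.1, ha.2, hb.2]) ⟨hw, h⟩ ⟨hw', rfl⟩
    simpa using this
  choose! s hsE hs using fun (x : ℂ) (hx : x ∈ ℓ '' E) => hx
  have hsG : ∀ w ∈ E, G (s (ℓ w)) = G w := fun w hw =>
    hfib _ (hsE _ ⟨w, hw, rfl⟩) _ hw (hs _ ⟨w, hw, rfl⟩)
  refine ⟨fun x => G (s x), ?_, ?_⟩
  · rintro _ ⟨w, hw, rfl⟩
    refine ContinuousAt.continuousWithinAt ?_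
    have hcurve : Continuous fun x : ℂ => w + (x - ℓ w) • v := by fun_prop
    have hw0 : w + (ℓ w - ℓ w) • v = w := by simp
    have hev : (fun x => G (w + (x - ℓ w) • v)) =ᶠ[𝓝 (ℓ w)] fun x => G (s x) := by
      filter_upwards [(hEo.preimage hcurve).mem_nhds (by simpa using hw)] with x hx
      rw [← hsG _ hx]
      simp [hv]
    refine ContinuousAt.congr ?_ hev
    refine ContinuousAt.comp (g := G) ?_ hcurve.continuousAt
    rw [hw0]
    exact hGc.continuousAt (hEo.mem_nhds hw)
  · rintro _ ⟨w, hw, rfl⟩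
    simp only [hsG w hw, hG w hw]

/-- The cones over a pencil of subspaces containing `H` and parametrised by `A + t • B` carry a
global continuous logarithm of the fibre coordinate, when `a + H` misses `D` but every subspace of
the pencil meets it. -/
lemma LogConvex.exists_log_pencil {D : Set V} (hD : LogConvex D) (hDo : IsOpen D) {a : V}
    {H : Submodule ℂ V} (hH : ∀ h ∈ H, a + h ∉ D) {A B : V} (hu : ∀ t : ℂ, A + t • B ∉ H)
    (hmeet : ∀ t : ℂ, ∃ x : ℂ, ∃ h ∈ H, a + x • (A + t • B) + h ∈ D) :
    IsOpen {q : ℂ × ℂ | ∃ h ∈ H, a + q.2 • (A + q.1 • B) + h ∈ D} ∧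
    (∀ t : ℂ, IsPreconnected {x : ℂ | ∃ h ∈ H, a + x • (A + t • B) + h ∈ D}) ∧
    ∃ g : ℂ × ℂ → ℂ, ContinuousOn g {q : ℂ × ℂ | ∃ h ∈ H, a + q.2 • (A + q.1 • B) + h ∈ D} ∧
      ∀ q : ℂ × ℂ, (∃ h ∈ H, a + q.2 • (A + q.1 • B) + h ∈ D) → exp (g q) = q.2 := by
  have hWo : IsOpen {q : ℂ × ℂ | ∃ h ∈ H, a + q.2 • (A + q.1 • B) + h ∈ D} := by
    have : {q : ℂ × ℂ | ∃ h ∈ H, a + q.2 • (A + q.1 • B) + h ∈ D} =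
        ⋃ h ∈ H, {q : ℂ × ℂ | a + q.2 • (A + q.1 • B) + h ∈ D} := by ext; simp
    rw [this]
    exact isOpen_biUnion fun h _ => hDo.preimage (by fun_prop)
  have hslice : ∀ t : ℂ, ∃ E : Set (ℂ × H), IsOpen E ∧ LogConvex E ∧ E.Nonempty ∧
      {x : ℂ | ∃ h ∈ H, a + x • (A + t • B) + h ∈ D} = ContinuousLinearMap.fst ℂ ℂ H '' E := by
    intro t
    let f : ℂ × H →ₗ[ℂ] V :=
      (LinearMap.toSpanSingleton ℂ V (A + t • B)).coprod H.subtype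
    have hf : ∀ q, f q = q.1 • (A + t • B) + q.2 := fun q => by simp [f]
    have hinj : Function.Injective f := by
      rw [← LinearMap.ker_eq_bot, LinearMap.ker_eq_bot']
      rintro ⟨x, h⟩ hq
      rw [hf] at hq
      have hx : x = 0 := by
        by_contra hx
        refine hu t ?_
        have : A + t • B = -(x⁻¹ • (h : V)) := by
          rw [eq_neg_iff_add_eq_zero, ← smul_right_injective V hx |>.eq_iff]
          simpa [smul_smul, hx] using hq
        rw [this]
        exact H.neg_mem (H.smul_mem _ h.2)
      subst hx
      simpa using hq
    have hE : {q : ℂ × H | a + f q ∈ D} = {q | a + q.1 • (A + t • B) + q.2 ∈ D} := by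
      ext q; simp only [mem_ofPred_eq, hf, add_assoc]
    refine ⟨{q | a + f q ∈ D}, ?_, hD.preimage a f hinj, ?_, ?_⟩
    · rw [hE]
      exact hDo.preimage (by fun_prop)
    · obtain ⟨x, h, hh, hx⟩ := hmeet t
      exact ⟨(x, ⟨h, hh⟩), by rw [hE]; exact hx⟩
    · rw [hE]
      ext x
      simp
  refine ⟨hWo, fun t => ?_, ?_⟩
  · obtain ⟨E, -, hE, -, h⟩ := hslice t
    rw [h]
    exact hE.isPreconnected.image _ (by fun_prop)
  · refine exists_log_of_fiberwise hWo (φ := fun q => q.2) (by fun_prop) hmeet (fun t => ?_)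
      fun t => ?_
    · obtain ⟨E, -, hE, -, h⟩ := hslice t
      simp only [mem_ofPred_eq]
      rw [h]
      exact hE.isPreconnected.image _ (by fun_prop)
    · obtain ⟨E, hEo, hE, hne, h⟩ := hslice t
      have h0 : ∀ w ∈ E, ContinuousLinearMap.fst ℂ ℂ H w ≠ 0 := by
        intro w hw hw0
        have : (0 : ℂ) ∈ {x : ℂ | ∃ h ∈ H, a + x • (A + t • B) + h ∈ D} := by
          rw [h]; exact ⟨w, hw, hw0⟩
        obtain ⟨h, hh, hd⟩ := this
        exact hH h hh (by simpa using hd)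
      obtain ⟨g, hgc, hg⟩ := hE.exists_log_image hEo hne (ContinuousLinearMap.fst ℂ ℂ H)
        (v := (1, 0)) rfl h0
      refine ⟨g, ?_, fun x hx => ?_⟩
      · simp only [mem_ofPred_eq]; rwa [h]
      · have hx' : x ∈ {x : ℂ | ∃ h ∈ H, a + x • (A + t • B) + h ∈ D} := hx
        rw [h] at hx'
        simpa using hg x hx'

end LogConvex
/-- Through every point of the complement of an open `LogConvex` set passes a complex affine
hyperplane missing the set. -/
theorem LogConvex.exists_forall_apply_ne {V : Type*} [NormedAddCommGroup V] [NormedSpace ℂ V]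
    [FiniteDimensional ℂ V] {D : Set V} (hD : LogConvex D) (hDo : IsOpen D) (hne : D.Nonempty)
    {a : V} (ha : a ∉ D) : ∃ b : V →L[ℂ] ℂ, ∀ w ∈ D, b w ≠ b a := by
  obtain ⟨H, hH, hmax⟩ : ∃ H : Submodule ℂ V, (∀ h ∈ H, a + h ∉ D) ∧
      ∀ H' : Submodule ℂ V, H < H' → ∃ h ∈ H', a + h ∈ D := by
    obtain ⟨H, hH, h⟩ := WellFounded.has_min (wellFounded_gt (α := Submodule ℂ V))
      {H | ∀ h ∈ H, a + h ∉ D} ⟨⊥, by simpa using ha⟩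
    refine ⟨H, hH, fun H' hlt => ?_⟩
    by_contra! hcon
    exact h H' hcon hlt
  obtain ⟨w₀, hw₀⟩ := hne
  set e₁ := w₀ - a with he₁
  have he₁H : e₁ ∉ H := fun h => hH _ h (by simpa [he₁] using hw₀)
  by_cases htop : H ⊔ Submodule.span ℂ {e₁} = ⊤
  · obtain ⟨f, hf, hfH⟩ := Submodule.exists_le_ker_of_notMem he₁H
    refine ⟨LinearMap.toContinuousLinearMap f, fun w hw heq => ?_⟩
    have hwa : f (w - a) = 0 := by
      rw [map_sub, sub_eq_zero]; exact heq
    have hmem : w - a ∈ H ⊔ Submodule.span ℂ {e₁} := by rw [htop]; trivial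
    obtain ⟨h, hh, k, hk, hsum⟩ := Submodule.mem_sup.1 hmem
    obtain ⟨c, rfl⟩ := Submodule.mem_span_singleton.1 hk
    have hfh : f h = 0 := hfH hh
    rw [← hsum, map_add, map_smul, hfh, zero_add, smul_eq_mul] at hwa
    obtain rfl | h0 := mul_eq_zero.1 hwa
    · refine hH h hh ?_
      rw [zero_smul, add_zero] at hsum
      rw [hsum]
      simpa using hw
    · exact hf h0
  exfalso
  obtain ⟨e₂, he₂⟩ : ∃ e₂, e₂ ∉ H ⊔ Submodule.span ℂ {e₁} := by
    by_contra! hcon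
    exact htop (eq_top_iff.2 fun x _ => hcon x)
  have hmeet : ∀ u ∉ H, ∃ x : ℂ, ∃ h ∈ H, a + x • u + h ∈ D := by
    intro u hu
    obtain ⟨y, hy, hyD⟩ := hmax (H ⊔ Submodule.span ℂ {u})
      (lt_of_le_of_ne le_sup_left fun h => hu (by
        rw [h]; exact Submodule.mem_sup_right (Submodule.mem_span_singleton_self u)))
    obtain ⟨h, hh, k, hk, rfl⟩ := Submodule.mem_sup.1 hy
    obtain ⟨c, rfl⟩ := Submodule.mem_span_singleton.1 hk
    exact ⟨c, h, hh, by rwa [add_assoc, add_comm _ h]⟩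
  have hu₁ : ∀ t : ℂ, e₁ + t • e₂ ∉ H := by
    intro t ht
    obtain rfl | h0 := eq_or_ne t 0
    · exact he₁H (by simpa using ht)
    · refine he₂ ?_
      have : e₂ = t⁻¹ • ((e₁ + t • e₂) - e₁) := by simp [smul_smul, h0]
      rw [this]
      exact Submodule.smul_mem _ _ (Submodule.sub_mem _ (Submodule.mem_sup_left ht)
        (Submodule.mem_sup_right (Submodule.mem_span_singleton_self _)))
  have hu₂ : ∀ t : ℂ, e₂ + t • e₁ ∉ H := by
    intro t ht
    refine he₂ ?_
    have : e₂ = (e₂ + t • e₁) - t • e₁ := by simp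
    rw [this]
    exact Submodule.sub_mem _ (Submodule.mem_sup_left ht)
        (Submodule.mem_sup_right (Submodule.smul_mem _ _ (Submodule.mem_span_singleton_self _)))
  obtain ⟨hW₁, hcon, g₁, hg₁c, hg₁⟩ := hD.exists_log_pencil hDo hH hu₁ fun t => hmeet _ (hu₁ t)
  obtain ⟨hW₂, -, g₂, hg₂c, hg₂⟩ := hD.exists_log_pencil hDo hH hu₂ fun t => hmeet _ (hu₂ t)
  set W₁ := {q : ℂ × ℂ | ∃ h ∈ H, a + q.2 • (e₁ + q.1 • e₂) + h ∈ D} with hW₁def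
  set W₂ := {q : ℂ × ℂ | ∃ h ∈ H, a + q.2 • (e₂ + q.1 • e₁) + h ∈ D} with hW₂def
  have hswap : ∀ t x : ℂ, t ≠ 0 → (t, x) ∈ W₁ → (t⁻¹, t * x) ∈ W₂ := by
    rintro t x ht ⟨h, hh, hd⟩
    refine ⟨h, hh, ?_⟩
    convert hd using 2
    simp only [smul_add, smul_smul]
    rw [mul_comm t x, mul_assoc, mul_inv_cancel₀ ht, mul_one, add_comm (x • e₁)]
  set Δ : ℂ → ℂ → ℂ := fun t x => g₁ (t, x) - g₂ (t⁻¹, t * x) with hΔ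
  have hΔexp : ∀ t x : ℂ, t ≠ 0 → (t, x) ∈ W₁ → exp (Δ t x) = t⁻¹ := by
    intro t x ht hx
    have hx0 : x ≠ 0 := by
      have := hg₁ (t, x) hx
      simp only at this
      rw [← this]
      exact exp_ne_zero _
    rw [hΔ]
    simp only
    rw [exp_sub, hg₁ _ hx, hg₂ _ (hswap t x ht hx)]
    field_simp
  have hΔcont : ∀ t x : ℂ, t ≠ 0 → (t, x) ∈ W₁ →
      ContinuousAt (fun q : ℂ × ℂ => Δ q.1 q.2) (t, x) := by
    intro t x ht hx
    refine (hg₁c.continuousAt (hW₁.mem_nhds hx)).sub ?_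
    refine ContinuousAt.comp (x := ((t, x) : ℂ × ℂ))
      (f := fun q : ℂ × ℂ => (q.1⁻¹, q.1 * q.2)) (g := g₂)
      (hg₂c.continuousAt (hW₂.mem_nhds (hswap t x ht hx))) ?_
    exact (continuousAt_fst.inv₀ ht).prodMk (by fun_prop)
  have hΔconst : ∀ t x y : ℂ, t ≠ 0 → (t, x) ∈ W₁ → (t, y) ∈ W₁ → Δ t x = Δ t y := by
    intro t x y ht hx hy
    have := sub_eq_sub_of_exp_eq (hcon t) (g := Δ t) (h := fun _ => 0) (fun x hx =>
      ((hΔcont t x ht hx).comp (f := fun x => (t, x)) (by fun_prop)).continuousWithinAt)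
      continuousOn_const (fun a ha b hb => by
        rw [sub_zero, sub_zero, hΔexp t a ht ha, hΔexp t b ht hb]) hx hy
    simpa using this
  choose ξ hξ using fun t => hmeet _ (hu₁ t)
  have hξ' : ∀ t, (t, ξ t) ∈ W₁ := hξ
  set τ : ℝ → ℂ := fun θ => exp (θ * I) with hτ
  have hτ0 : ∀ θ, τ θ ≠ 0 := fun θ => exp_ne_zero _
  have hτc : Continuous τ := by fun_prop
  have hΦ : Continuous fun θ : ℝ => Δ (τ θ) (ξ (τ θ)) := by
    rw [continuous_iff_continuousAt]
    intro θ₀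
    have hcurve : Continuous fun θ : ℝ => (τ θ, ξ (τ θ₀)) := by fun_prop
    have hev : (fun θ : ℝ => Δ (τ θ) (ξ (τ θ₀))) =ᶠ[𝓝 θ₀] fun θ => Δ (τ θ) (ξ (τ θ)) := by
      filter_upwards [(hW₁.preimage hcurve).mem_nhds (hξ' (τ θ₀))] with θ hθ
      exact hΔconst _ _ _ (hτ0 θ) hθ (hξ' _)
    exact ContinuousAt.congr (ContinuousAt.comp (x := θ₀) (f := fun θ : ℝ => (τ θ, ξ (τ θ₀)))
      (hΔcont _ _ (hτ0 _) (hξ' _)) hcurve.continuousAt) hev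
  have hfin := sub_eq_sub_of_exp_eq (isPreconnected_univ (α := ℝ))
    (g := fun θ : ℝ => Δ (τ θ) (ξ (τ θ))) (h := fun θ : ℝ => -(θ * I)) hΦ.continuousOn
    (by fun_prop) (by
      have : ∀ θ : ℝ, exp (Δ (τ θ) (ξ (τ θ)) - -(θ * I)) = 1 := by
        intro θ
        rw [sub_neg_eq_add, exp_add, hΔexp _ _ (hτ0 θ) (hξ' _)]
        exact inv_mul_cancel₀ (hτ0 θ)
      intro a _ b _
      rw [this, this]) (mem_univ 0) (mem_univ (2 * Real.pi))
  have h2π : τ (2 * Real.pi) = τ 0 := by simp [hτ]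
  simp only [h2π] at hfin
  simp at hfin

theorem IsCConvex.logConvex {n : ℕ} {D : Set (Cn n)} (hD : IsCConvex D) (hDo : IsOpen D) :
    LogConvex D := by
  intro p hp v hv
  set S : Set ℂ := {l : ℂ | p + l • v ∈ D} with hS
  have hSo : IsOpen S := hDo.preimage (by fun_prop : Continuous fun l : ℂ => p + l • v)
  obtain ⟨hconn, hsc⟩ := hD p v hv ⟨p, hp, 0, by simp⟩
  let inv : Cn n → ℂ := fun w => inner ℂ v (w - p) / inner ℂ v v
  have hvv : inner ℂ v v ≠ 0 := inner_self_ne_zero.mpr hv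
  have hinv : ∀ l : ℂ, inv (p + l • v) = l := by
    intro l
    simp only [inv, add_sub_cancel_left, inner_smul_right]
    field_simp
  have hinvc : Continuous inv := by fun_prop
  have hsub : ∀ w ∈ D ∩ cline p v, p + inv w • v = w := by
    rintro w ⟨-, l, rfl⟩
    rw [hinv]
  let e : S ≃ₜ ↥(D ∩ cline p v) :=
    { toFun := fun l => ⟨p + (l : ℂ) • v, l.2, l, rfl⟩
      invFun := fun w => ⟨inv w, by
        change p + inv w • v ∈ D
        rw [hsub w w.2]
        exact w.2.1⟩
      left_inv := fun l => Subtype.ext (hinv l)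
      right_inv := fun w => Subtype.ext (hsub w w.2)
      continuous_toFun := by fun_prop
      continuous_invFun := by fun_prop }
  have hsc' : IsSimplyConnected S := e.toHomotopyEquiv.simplyConnectedSpace
  refine ⟨hsc'.isPathConnected.isConnected.isPreconnected, fun α β h => ?_⟩
  obtain ⟨g, hg, hge⟩ := Complex.exists_continuousOn_eqOn_exp_comp hsc' hSo
    (g := fun l => α + β * l) (by fun_prop) (by
      rintro ⟨l, hl, hl0⟩
      exact h l hl hl0)
  exact ⟨g, hg, fun l hl => hge hl⟩

section AdaptedCoordinates

variable {V : Type*} [NormedAddCommGroup V] [NormedSpace ℂ V]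

/-- The functionals `b` whose hyperplane `b (w - z) = 1` misses `D`. -/
def polarDual (D : Set V) (z : V) : Set (V →L[ℂ] ℂ) := {b | ∀ w ∈ D, b (w - z) ≠ 1}

lemma norm_apply_mul_le_one_of_mem_polarDual {D : Set V} {z : V} {b : V →L[ℂ] ℂ}
    (hb : b ∈ polarDual D z) {x : V} {r : ℝ} (hr : 0 < r)
    (hx : ∀ l : ℂ, ‖l‖ < r → z + l • x ∈ D) : ‖b x‖ * r ≤ 1 := by
  by_contra! h
  have h0 : 0 < ‖b x‖ := by
    by_contra! h0
    nlinarith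
  refine hb _ (hx (b x)⁻¹ ?_) ?_
  · rw [norm_inv, inv_lt_iff_one_lt_mul₀ h0, mul_comm]
    linarith
  · rw [add_sub_cancel_left, map_smul, smul_eq_mul, inv_mul_cancel₀ (norm_pos_iff.mp h0)]

lemma isCompact_polarDual [FiniteDimensional ℂ V] {D : Set V} (hDo : IsOpen D) {z : V}
    (hz : z ∈ D) : IsCompact (polarDual D z) := by
  have : ProperSpace (V →L[ℂ] ℂ) := FiniteDimensional.proper ℂ _
  refine Metric.isCompact_of_isClosed_isBounded ?_ ?_
  · rw [← isOpen_compl_iff, isOpen_iff_mem_nhds]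
    intro b₀ hb₀
    simp only [polarDual, mem_compl_iff, mem_ofPred_eq, not_forall, not_not] at hb₀
    obtain ⟨w, hw, hbw⟩ := hb₀
    have hev : Continuous fun b : V →L[ℂ] ℂ => b (w - z) := by fun_prop
    have hne : ∀ᶠ b in 𝓝 b₀, b (w - z) ≠ 0 :=
      hev.continuousAt.eventually_ne (by simp [hbw])
    have hc : ContinuousAt (fun b : V →L[ℂ] ℂ => z + (b (w - z))⁻¹ • (w - z)) b₀ :=
      continuousAt_const.add ((hev.continuousAt.inv₀ (by simp [hbw])).smul continuousAt_const)
    have hD : ∀ᶠ b in 𝓝 b₀, z + (b (w - z))⁻¹ • (w - z) ∈ D :=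
      hc.eventually_mem (hDo.mem_nhds (by simpa [hbw] using hw))
    filter_upwards [hne, hD] with b h1 h2 h3
    exact h3 _ h2 (by
      rw [add_sub_cancel_left, map_smul, smul_eq_mul, inv_mul_cancel₀ h1])
  · obtain ⟨ε, hε, hball⟩ := Metric.isOpen_iff.mp hDo z hz
    refine isBounded_iff_forall_norm_le.mpr ⟨ε⁻¹, fun b hb => ?_⟩
    refine b.opNorm_le_bound (by positivity) fun x => ?_
    obtain rfl | hx := eq_or_ne x 0
    · simp
    have hx' := norm_pos_iff.mpr hx
    have h := norm_apply_mul_le_one_of_mem_polarDual hb (x := x) (r := ε / ‖x‖)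
      (by positivity) fun l hl => hball (by
        rw [mem_ball, dist_eq_norm, add_sub_cancel_left, norm_smul]
        exact (lt_div_iff₀ hx').mp hl)
    rw [← mul_div_assoc, div_le_one hx'] at h
    rwa [inv_mul_eq_div, le_div_iff₀ hε]

lemma exists_mem_polarDual_eq_one {D : Set V} {z : V} (hz : z ∈ D)
    (hlin : ∀ a ∉ D, ∃ b : V →L[ℂ] ℂ, ∀ w ∈ D, b w ≠ b a) {x : V} (hx : z + x ∉ D) :
    ∃ b ∈ polarDual D z, b x = 1 := by
  obtain ⟨b, hb⟩ := hlin _ hx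
  have h0 : b x ≠ 0 := fun h => hb z hz (by simp [h])
  refine ⟨(b x)⁻¹ • b, fun w hw h => hb w hw ?_, by simp [h0]⟩
  rw [smul_apply, smul_eq_mul, inv_mul_eq_one₀ h0, map_sub] at h
  rw [map_add, h]
  ring

lemma exists_coordinates_of_compact_spanning [FiniteDimensional ℂ V] {n : ℕ}
    (hn : Module.finrank ℂ V = n) {B : Set (V →L[ℂ] ℂ)} (hB : IsCompact B)
    (hsep : ∀ v : V, (∀ b ∈ B, b v = 0) → v = 0) :
    ∃ A : V ≃L[ℂ] (Fin n → ℂ), (∀ k, ∃ b ∈ B, ∀ v, A v k = b v) ∧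
      ∀ b ∈ B, ∃ c : Fin n → ℂ, (∀ k, ‖c k‖ ≤ 1) ∧ ∀ v, b v = ∑ k, c k * A v k := by
  let e : Module.Basis (Fin n) ℂ V := Module.finBasisOfFinrankEq ℂ V hn
  let d := e.dualBasis
  let toL : (V →L[ℂ] ℂ) → Module.Dual ℂ V := fun b => b.toLinearMap
  let F : (Fin n → V →L[ℂ] ℂ) → ℂ := fun β => d.det fun i => toL (β i)
  have hF : Continuous F := by
    have : F = fun β => Matrix.det (Matrix.of fun i j => β j (e i)) := by
      funext β
      simp only [F, Module.Basis.det_apply]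
      congr 1
      ext i j
      simp [Module.Basis.toMatrix_apply, d, toL]
    rw [this]
    refine Continuous.matrix_det ?_
    refine continuous_matrix fun i j => ?_
    simp only [Matrix.of_apply]
    fun_prop
  have hspan : ⊤ ≤ Submodule.span ℂ (toL '' B) := by
    rw [top_le_iff, ← Subspace.dualCoannihilator_dualAnnihilator_eq
      (W := Submodule.span ℂ (toL '' B))]
    have : (Submodule.span ℂ (toL '' B)).dualCoannihilator = ⊥ := by
      rw [eq_bot_iff]
      intro v hv
      rw [Submodule.mem_dualCoannihilator] at hv
      exact hsep v fun b hb => hv _ (Submodule.subset_span ⟨b, hb, rfl⟩)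
    rw [this, Submodule.dualAnnihilator_bot]
  obtain ⟨β₀, hβ₀B, hβ₀⟩ : ∃ β : Fin n → V →L[ℂ] ℂ, (∀ i, β i ∈ B) ∧ F β ≠ 0 := by
    let s := Module.Basis.ofSpan hspan
    have : Fintype ((linearIndepOn_empty ℂ (id : Module.Dual ℂ V → _)).extend
      (empty_subset (toL '' B))) := FiniteDimensional.fintypeBasisIndex s
    let σ := Fintype.equivFinOfCardEq
      ((Module.finrank_eq_card_basis s).symm.trans ((Subspace.dual_finrank_eq).trans hn))
    have hmem : ∀ i, ∃ b ∈ B, toL b = s (σ.symm i) := fun i =>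
      Module.Basis.ofSpan_subset hspan ⟨_, rfl⟩
    choose β hβ hβs using hmem
    refine ⟨β, hβ, ?_⟩
    have h : F β = d.det (s.reindex σ) := by
      simp only [F, hβs]
      congr 1
      ext1 i
      simp
    rw [h]
    exact (d.isUnit_det _).ne_zero
  obtain ⟨β, hβB, hmax⟩ := (isCompact_univ_pi fun _ : Fin n => hB).exists_isMaxOn
    ⟨β₀, fun i _ => hβ₀B i⟩ hF.norm.continuousOn
  have hβ0 : F β ≠ 0 := by
    have := hmax (fun i _ => hβ₀B i : β₀ ∈ univ.pi fun _ => B)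
    exact norm_pos_iff.mp ((norm_pos_iff.mpr hβ₀).trans_le this)
  obtain ⟨hli, hsp⟩ := (d.is_basis_iff_det).mpr (isUnit_iff_ne_zero.mpr hβ0)
  let bB := Module.Basis.mk hli hsp.ge
  have hcoord : ∀ b ∈ B, ∀ k, ‖bB.coord k (toL b)‖ ≤ 1 := by
    intro b hb k
    have h := LinearMap.congr_fun (d.det_smul_mk_coord_eq_det_update hli hsp.ge k) (toL b)
    have h' : F β * bB.coord k (toL b) = F (Function.update β k b) := by
      refine h.trans ?_
      simp only [F, MultilinearMap.toLinearMap_apply, AlternatingMap.coe_multilinearMap]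
      congr 1
      ext1 i
      obtain rfl | hik := eq_or_ne i k
      · simp
      · simp [hik]
    have hm := hmax (show Function.update β k b ∈ univ.pi fun _ => B from fun i _ => by
      obtain rfl | hik := eq_or_ne i k
      · simpa using hb
      · simpa [hik] using hβB i (mem_univ i))
    simp only [mem_ofPred_eq, ← h', norm_mul] at hm
    exact (mul_le_iff_le_one_right (norm_pos_iff.mpr hβ0)).mp hm
  have hexp : ∀ (b : V →L[ℂ] ℂ) v, b v = ∑ k, bB.coord k (toL b) * β k v := by
    intro b v
    have h := LinearMap.congr_fun (bB.sum_repr (toL b)) v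
    simp only [LinearMap.sum_apply, LinearMap.smul_apply, smul_eq_mul] at h
    refine h.symm.trans (Finset.sum_congr rfl fun k _ => ?_)
    simp [bB, toL]
  let A₀ : V →ₗ[ℂ] (Fin n → ℂ) := LinearMap.pi fun k => toL (β k)
  have hA₀ : Function.Injective A₀ := by
    rw [injective_iff_map_eq_zero]
    intro v hv
    refine hsep v fun b _ => ?_
    rw [hexp b v]
    exact Finset.sum_eq_zero fun k _ => by
      have : β k v = 0 := congrFun hv k
      rw [this, mul_zero]
  let A := (LinearMap.linearEquivOfInjective A₀ hA₀ (by simp [hn])).toContinuousLinearEquiv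
  have hA : ∀ v k, A v k = β k v := fun v k => rfl
  exact ⟨A, fun k => ⟨β k, hβB k (mem_univ k), fun v => hA v k⟩,
    fun b hb => ⟨fun k => bB.coord k (toL b), hcoord b hb, fun v => by
      simp only [hA]; exact hexp b v⟩⟩

theorem exists_adapted_coordinates [FiniteDimensional ℂ V] {n : ℕ}
    (hn : Module.finrank ℂ V = n) {D : Set V} (hDo : IsOpen D) {z : V} (hz : z ∈ D)
    (hlin : ∀ a ∉ D, ∃ b : V →L[ℂ] ℂ, ∀ w ∈ D, b w ≠ b a)
    (hline : ∀ v : V, v ≠ 0 → ∃ l : ℂ, z + l • v ∉ D) :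
    ∃ A : V ≃L[ℂ] (Fin n → ℂ), (∀ k, ∀ w ∈ D, A (w - z) k ≠ 1) ∧
      (∀ k, ∀ l : ℂ, ‖l‖ < 1 → ∃ w ∈ D, A (w - z) k = l) ∧
      ∀ (X : V) (r : ℝ), 0 < r → (∀ l : ℂ, ‖l‖ < r → z + l • X ∈ D) →
        ∀ w : V, (∀ k, ‖A w k‖ ≤ 1 / (2 * (n + 1))) → ∀ l : ℂ, ‖l‖ ≤ r / 2 →
          z + l • X + w ∈ D := by
  obtain ⟨A, hAB, hAc⟩ := exists_coordinates_of_compact_spanning hn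
    (isCompact_polarDual hDo hz) (fun v hv => by
      by_contra hv0
      obtain ⟨l, hl⟩ := hline v hv0
      obtain ⟨b, hb, hb1⟩ := exists_mem_polarDual_eq_one hz hlin hl
      simp [hv b hb] at hb1)
  refine ⟨A, fun k w hw => ?_, fun k l hl => ?_, fun X r hr hX w hw l hl => ?_⟩
  · obtain ⟨b, hb, hbA⟩ := hAB k
    rw [hbA]
    exact hb w hw
  · refine ⟨z + l • A.symm (Pi.single k 1), ?_, by simp⟩
    by_contra hout
    obtain ⟨b, hb, hb1⟩ := exists_mem_polarDual_eq_one hz hlin hout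
    obtain ⟨c, hc, hbc⟩ := hAc b hb
    have : b (l • A.symm (Pi.single k 1)) = l * c k := by
      simp [hbc, Pi.single_apply, mul_comm]
    rw [this] at hb1
    have h1 : ‖l * c k‖ < 1 := by
      rw [norm_mul]
      exact (mul_le_of_le_one_right (norm_nonneg _) (hc k)).trans_lt hl
    simp [hb1] at h1
  · by_contra hout
    rw [add_assoc] at hout
    obtain ⟨b, hb, hb1⟩ := exists_mem_polarDual_eq_one hz hlin hout
    obtain ⟨c, hc, hbc⟩ := hAc b hb
    have hbX := norm_apply_mul_le_one_of_mem_polarDual hb hr hX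
    have hbl : ‖b (l • X)‖ ≤ 1 / 2 := by
      rw [map_smul, norm_smul]
      nlinarith [norm_nonneg (b X), norm_nonneg l]
    have hbw : ‖b w‖ < 1 / 2 := by
      rw [hbc]
      calc ‖∑ k, c k * A w k‖ ≤ ∑ _k : Fin n, 1 / (2 * ((n : ℝ) + 1)) :=
            norm_sum_le_of_le _ fun k _ => by
              rw [norm_mul]
              exact (mul_le_of_le_one_left (norm_nonneg _) (hc k)).trans (hw k)
        _ = n / (2 * ((n : ℝ) + 1)) := by simp [div_eq_mul_inv]
        _ < 1 / 2 := by
          rw [div_lt_div_iff₀ (by positivity) (by norm_num)]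
          linarith
    have h1 : ‖b (l • X + w)‖ < 1 := by
      rw [map_add]
      exact (norm_add_le _ _).trans_lt (by linarith)
    simp [hb1] at h1

end AdaptedCoordinates

section MeanValue

open scoped ENNReal

lemma sq_enorm_mul_le_lintegral_circle {φ : ℂ → ℂ} {U : Set ℂ}
    (hU : closedBall 0 1 ⊆ U) (hφ : DifferentiableOn ℂ φ U) :
    ‖φ 0‖ₑ ^ 2 * ENNReal.ofReal (2 * Real.pi) ≤
      ∫⁻ θ in Ioc 0 (2 * Real.pi), ‖φ (circleMap 0 1 θ)‖ₑ ^ 2 := by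
  have hd : DiffContOnCl ℂ (fun l => φ l ^ 2) (ball 0 |(1 : ℝ)|) := by
    rw [abs_one]
    refine DifferentiableOn.diffContOnCl ?_
    rw [closure_ball _ one_ne_zero]
    exact (hφ.mono hU).pow 2
  have h := hd.circleAverage
  rw [Real.circleAverage, inv_smul_eq_iff₀ (by positivity),
    intervalIntegral.integral_of_le (by positivity)] at h
  have h2 := enorm_integral_le_lintegral_enorm (μ := volume.restrict (Ioc 0 (2 * Real.pi)))
    fun θ => φ (circleMap 0 1 θ) ^ 2
  rw [h] at h2
  simp only [enorm_smul, enorm_pow] at h2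
  rwa [mul_comm, ← Real.enorm_of_nonneg (by positivity)]

variable {V : Type*} [NormedAddCommGroup V] [NormedSpace ℂ V] [FiniteDimensional ℂ V]
  [MeasurableSpace V] [BorelSpace V] (μ : Measure V) [μ.IsAddHaarMeasure]

lemma lintegral_comp_smul_of_norm_eq_one {c : ℂ} (hc : ‖c‖ = 1) {F : V → ℝ≥0∞}
    (hF : Measurable F) : ∫⁻ w, F (c • w) ∂μ = ∫⁻ w, F w ∂μ := by
  have : FiniteDimensional ℝ V := FiniteDimensional.complexToReal V
  have : ProperSpace V := FiniteDimensional.proper ℂ V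
  have hc0 : c ≠ 0 := by
    rintro rfl
    simp at hc
  let T : V →ₗ[ℝ] V := DistribSMul.toLinearMap ℝ V c
  have hball : T '' ball 0 1 = ball 0 1 := by
    ext w
    constructor
    · rintro ⟨v, hv, rfl⟩
      simpa [T, norm_smul, hc] using hv
    · intro hw
      exact ⟨c⁻¹ • w, by simpa [norm_smul, hc] using hw, by simp [T, smul_smul, hc0]⟩
  have h := Measure.addHaar_image_linearMap μ T (ball 0 1)
  rw [hball] at h
  have hdet : |LinearMap.det T| = 1 := by
    have h0 : μ (ball (0 : V) 1) ≠ 0 := (measure_ball_pos μ 0 one_pos).ne'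
    have h1 : μ (ball (0 : V) 1) ≠ ∞ := measure_ball_lt_top.ne
    have := (ENNReal.mul_eq_right h0 h1).mp h.symm
    simpa using this
  have hmap : μ.map (c • · : V → V) = μ := by
    have := Measure.map_linearMap_addHaar_eq_smul_addHaar μ (f := T) (by
      intro h0
      simp [h0] at hdet)
    rw [abs_inv, hdet] at this
    simp only [inv_one, ENNReal.ofReal_one, one_smul] at this
    exact this
  conv_rhs => rw [← hmap]
  rw [lintegral_map hF (measurable_const_smul c)]

theorem sq_enorm_mul_measure_le_lintegral {P D : Set V} (hP : MeasurableSet P)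
    (hbal : ∀ w ∈ P, ∀ l : ℂ, ‖l‖ ≤ 1 → l • w ∈ P) (hD : IsOpen D) {p : V}
    (hPD : ∀ w ∈ P, p + w ∈ D) {f : V → ℂ} (hf : DifferentiableOn ℂ f D) :
    ‖f p‖ₑ ^ 2 * μ P ≤ ∫⁻ w in D, ‖f w‖ₑ ^ 2 ∂μ := by
  have : ProperSpace V := FiniteDimensional.proper ℂ V
  let F : V → ℝ≥0∞ := D.indicator fun w => ‖f w‖ₑ ^ 2
  have hF : Measurable F := by
    classical
    rw [show F = D.piecewise (fun w => ‖f w‖ₑ ^ 2) 0 from piecewise_eq_indicator.symm]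
    exact ContinuousOn.measurable_piecewise
      ((ENNReal.continuous_pow 2).comp_continuousOn hf.continuousOn.enorm)
      continuousOn_const hD.measurableSet
  have hmv : ∀ w ∈ P, ‖f p‖ₑ ^ 2 * ENNReal.ofReal (2 * Real.pi) ≤
      ∫⁻ θ in Ioc 0 (2 * Real.pi), F (p + circleMap 0 1 θ • w) := by
    intro w hw
    have hline : Differentiable ℂ fun l : ℂ => p + l • w := by fun_prop
    have hsub : ∀ l : ℂ, ‖l‖ ≤ 1 → p + l • w ∈ D := fun l hl => hPD _ (hbal w hw l hl)
    have h := sq_enorm_mul_le_lintegral_circle (φ := fun l => f (p + l • w))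
      (fun l hl => hsub l (by simpa using hl))
      (hf.comp hline.differentiableOn fun l hl => hl)
    simp only [zero_smul, add_zero] at h
    refine h.trans (lintegral_mono fun θ => ?_)
    rw [show F (p + circleMap 0 1 θ • w) = ‖f (p + circleMap 0 1 θ • w)‖ₑ ^ 2 from
      indicator_of_mem (hsub _ (by simp)) _]
  have hf_int : ∫⁻ w in D, ‖f w‖ₑ ^ 2 ∂μ = ∫⁻ w, F w ∂μ :=
    (lintegral_indicator hD.measurableSet _).symm
  have hpi : ENNReal.ofReal (2 * Real.pi) ≠ 0 := by
    simp [Real.pi_pos]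
  have hmeas : Measurable fun x : V × ℝ => F (p + circleMap 0 1 x.2 • x.1) := by
    refine hF.comp (Continuous.measurable ?_)
    have := continuous_circleMap 0 1
    fun_prop
  have key : ‖f p‖ₑ ^ 2 * μ P * ENNReal.ofReal (2 * Real.pi) ≤
      (∫⁻ w in D, ‖f w‖ₑ ^ 2 ∂μ) * ENNReal.ofReal (2 * Real.pi) := by
    calc ‖f p‖ₑ ^ 2 * μ P * ENNReal.ofReal (2 * Real.pi)
        = ∫⁻ _w in P, ‖f p‖ₑ ^ 2 * ENNReal.ofReal (2 * Real.pi) ∂μ := by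
          rw [setLIntegral_const]
          ring
      _ ≤ ∫⁻ w in P, (∫⁻ θ in Ioc 0 (2 * Real.pi), F (p + circleMap 0 1 θ • w)) ∂μ :=
          setLIntegral_mono' hP hmv
      _ = ∫⁻ θ in Ioc 0 (2 * Real.pi), (∫⁻ w in P, F (p + circleMap 0 1 θ • w) ∂μ) :=
          lintegral_lintegral_swap hmeas.aemeasurable
      _ ≤ ∫⁻ _θ in Ioc 0 (2 * Real.pi), (∫⁻ w, F w ∂μ) := by
          refine lintegral_mono fun θ => (setLIntegral_le_lintegral _ _).trans_eq ?_
          rw [lintegral_comp_smul_of_norm_eq_one μ (F := fun w => F (p + w)) (by simp)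
            (hF.comp (measurable_const_add p)), lintegral_add_left_eq_self]
      _ = _ := by
          rw [setLIntegral_const, hf_int, Real.volume_Ioc, sub_zero]
  exact (ENNReal.mul_le_mul_iff_left hpi ENNReal.ofReal_ne_top).mp key

end MeanValue

section Planar

open scoped ENNReal

lemma det_restrictScalars_smulRight_one (c : ℂ) :
    (((1 : ℂ →L[ℂ] ℂ).smulRight c).restrictScalars ℝ : ℂ →L[ℝ] ℂ).det = ‖c‖ ^ 2 := by
  rw [← Complex.normSq_eq_norm_sq, ← Algebra.norm_complex_apply, Algebra.norm_apply,
    ContinuousLinearMap.det]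
  congr 1
  ext x; simp [mul_comm]

lemma lintegral_sq_enorm_deriv_eq_volume_image {G : Set ℂ} (hG : MeasurableSet G)
    {φ h : ℂ → ℂ} (hφ : ∀ x ∈ G, HasDerivAt φ (h x) x) (hinj : InjOn φ G) :
    ∫⁻ x in G, ‖h x‖ₑ ^ 2 = volume (φ '' G) := by
  rw [← lintegral_abs_det_fderiv_eq_addHaar_image volume hG
    (fun x hx => ((hφ x hx).hasFDerivAt.restrictScalars ℝ).hasFDerivWithinAt) hinj]
  refine lintegral_congr fun x => ?_
  have := det_restrictScalars_smulRight_one (h x)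
  rw [show ContinuousLinearMap.toSpanSingleton ℂ (h x) = (1 : ℂ →L[ℂ] ℂ).smulRight (h x) by
    ext; simp, this, abs_of_nonneg (by positivity), ENNReal.ofReal_pow (norm_nonneg _),
    ofReal_norm]

lemma re_pos_of_sq_eq_one_sub {s : ℂ → ℂ} (hs : ContinuousOn s (ball 0 1)) (hs0 : s 0 = 1)
    (hsq : ∀ ζ ∈ ball (0 : ℂ) 1, s ζ ^ 2 = 1 - ζ) {ζ : ℂ} (hζ : ζ ∈ ball (0 : ℂ) 1) :
    0 < (s ζ).re := by
  by_contra! hneg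
  have hpre : IsPreconnected ((fun ζ => (s ζ).re) '' ball 0 1) :=
    (convex_ball (0 : ℂ) 1).isPreconnected.image _ (continuous_re.comp_continuousOn hs)
  obtain ⟨η, hη, hη0⟩ := hpre.ordConnected.out (mem_image_of_mem _ hζ)
    (mem_image_of_mem _ (mem_ball_self one_pos)) ⟨hneg, by simp [hs0]⟩
  have h := congrArg re (hsq η hη)
  have hη0 : (s η).re = 0 := hη0
  have hre : η.re < 1 := (re_le_norm η).trans_lt (by simpa using hη)
  simp [pow_two, hη0] at h
  nlinarith [mul_self_nonneg (s η).im]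

/-- A planar domain containing the unit disc and omitting `1`, with a logarithm of `ζ - 1`, carries
a holomorphic function with controlled norm which is not small at the origin. -/
theorem exists_holomorphic_of_log {G : Set ℂ} (hG : IsOpen G) (hball : ball 0 1 ⊆ G)
    {g : ℂ → ℂ} (hg : ContinuousOn g G) (hexp : ∀ ζ ∈ G, exp (g ζ) = ζ - 1) :
    ∃ h : ℂ → ℂ, DifferentiableOn ℂ h G ∧ ‖h 0‖ = 1 / 8 ∧
      ∫⁻ ζ in G, ‖h ζ‖ₑ ^ 2 ≤ ENNReal.ofReal (9 * Real.pi) := by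
  have h0 : (0 : ℂ) ∈ G := hball (mem_ball_self one_pos)
  let s : ℂ → ℂ := fun ζ => exp ((g ζ - g 0) / 2)
  have hsc : ContinuousOn s G := by fun_prop
  have hs0 : s 0 = 1 := by simp [s]
  have hsne : ∀ ζ, s ζ ≠ 0 := fun ζ => exp_ne_zero _
  have hsq : ∀ ζ ∈ G, s ζ ^ 2 = 1 - ζ := by
    intro ζ hζ
    rw [← exp_nat_mul, Nat.cast_ofNat, mul_div_cancel₀ _ two_ne_zero, exp_sub, hexp ζ hζ,
      hexp 0 h0]
    ring
  have hlow : ∀ ζ ∈ G, 1 / 3 ≤ ‖1 + s ζ‖ := by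
    intro ζ hζ
    by_contra! hlt
    have hfac : ζ = (1 + s ζ) * (2 - (1 + s ζ)) := by linear_combination hsq ζ hζ
    have h2 : ‖2 - (1 + s ζ)‖ ≤ 2 + 1 / 3 :=
      (norm_sub_le _ _).trans (by rw [RCLike.norm_ofNat]; linarith)
    have hζ1 : ζ ∈ ball (0 : ℂ) 1 := by
      rw [mem_ball_zero_iff, hfac, norm_mul]
      nlinarith [norm_nonneg (1 + s ζ), norm_nonneg (2 - (1 + s ζ))]
    have hpos := re_pos_of_sq_eq_one_sub (hsc.mono hball) hs0 (fun η hη => hsq η (hball hη)) hζ1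
    have := (re_le_norm (1 + s ζ)).trans_lt hlt
    simp at this
    linarith
  have hne : ∀ ζ ∈ G, 1 + s ζ ≠ 0 := by
    intro ζ hζ h
    have := hlow ζ hζ
    norm_num [h] at this
  have hsd : ∀ ζ ∈ G, HasDerivAt s (-(2 * s ζ))⁻¹ ζ := by
    intro ζ hζ
    refine HasDerivAt.of_local_left_inverse (f := fun w => 1 - w ^ 2)
      (hsc.continuousAt (hG.mem_nhds hζ)) ?_ (by simp [hsne]) ?_
    · simpa using ((hasDerivAt_id (s ζ)).pow 2).const_sub 1
    · filter_upwards [hG.mem_nhds hζ] with η hη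
      rw [hsq η hη]
      ring
  let h : ℂ → ℂ := fun ζ => (2 * s ζ * (1 + s ζ) ^ 2)⁻¹
  have hφ : ∀ ζ ∈ G, HasDerivAt (fun ζ => (1 + s ζ)⁻¹) (h ζ) ζ := by
    intro ζ hζ
    have := ((hsd ζ hζ).const_add 1).inv (hne ζ hζ)
    refine this.congr_deriv ?_
    have := hsne ζ
    have := hne ζ hζ
    simp only [h]
    field_simp
  have hinj : InjOn (fun ζ => (1 + s ζ)⁻¹) G := by
    intro ζ hζ η hη he
    have : s ζ = s η := by simpa using he
    have h1 := hsq ζ hζ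
    rw [this, hsq η hη] at h1
    linear_combination h1
  refine ⟨h, fun ζ hζ => ?_, ?_, ?_⟩
  · have hd := (hsd ζ hζ).differentiableAt
    exact (((hd.const_mul 2).mul ((hd.const_add 1).pow 2)).inv
      (by simp [hsne, hne ζ hζ])).differentiableWithinAt
  · simp only [h, hs0]
    norm_num
  · rw [lintegral_sq_enorm_deriv_eq_volume_image hG.measurableSet hφ hinj]
    calc volume ((fun ζ => (1 + s ζ)⁻¹) '' G) ≤ volume (closedBall (0 : ℂ) 3) := by
          refine measure_mono ?_
          rintro _ ⟨ζ, hζ, rfl⟩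
          rw [mem_closedBall_zero_iff, norm_inv]
          exact inv_le_of_inv_le₀ (by norm_num) (by simpa using hlow ζ hζ)
      _ = ENNReal.ofReal (9 * Real.pi) := by
          rw [Complex.volume_closedBall, ENNReal.ofReal_mul (by norm_num),
            ← ENNReal.ofReal_pow (by norm_num), ← NNReal.coe_real_pi, ENNReal.ofReal_coe_nnreal]
          norm_num

end Planar

section ProductMeasure

open scoped ENNReal NNReal

lemma lintegral_fin_prod_eq_prod {E : Type*} [MeasureSpace E]
    [SigmaFinite (volume : Measure E)] {n : ℕ} {H : Fin n → E → ℝ≥0∞}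
    (hH : ∀ k, Measurable (H k)) :
    ∫⁻ x : Fin n → E, ∏ k, H k (x k) = ∏ k, ∫⁻ x, H k x := by
  induction n with
  | zero => simp [volume_pi]
  | succ n ih =>
    have hmeas : Measurable fun x : Fin (n + 1) → E => ∏ k, H k (x k) :=
      Finset.measurable_prod _ fun k _ => (hH k).comp (measurable_pi_apply k)
    have hmp := (volume_preserving_piFinSuccAbove (fun _ : Fin (n + 1) => E) 0).symm
    rw [← hmp.lintegral_comp hmeas, Fin.prod_univ_succ, ← ih fun k => hH k.succ]
    have hmeas' : Measurable fun x : Fin n → E => ∏ k, H k.succ (x k) :=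
      Finset.measurable_prod _ fun k _ => (hH k.succ).comp (measurable_pi_apply k)
    rw [← lintegral_prod_mul (hH 0).aemeasurable hmeas'.aemeasurable]
    refine lintegral_congr fun x => ?_
    rw [Fin.prod_univ_succ]
    simp [MeasurableEquiv.piFinSuccAbove, Fin.insertNthEquiv]

variable {V : Type*} [NormedAddCommGroup V] [NormedSpace ℂ V]
  [MeasurableSpace V] [BorelSpace V] (μ : Measure V) [μ.IsAddHaarMeasure]

theorem exists_lintegral_prod_coordinates {n : ℕ} (A : V ≃L[ℂ] (Fin n → ℂ)) :
    ∃ J : ℝ≥0, 0 < J ∧ ∀ H : Fin n → ℂ → ℝ≥0∞, (∀ k, Measurable (H k)) →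
      ∫⁻ w, ∏ k, H k (A w k) ∂μ = J * ∏ k, ∫⁻ x, H k x := by
  have hA : (μ.map A).IsAddHaarMeasure := A.isAddHaarMeasure_map μ
  obtain ⟨J, hJ, hmap⟩ : ∃ J : ℝ≥0, 0 < J ∧ μ.map A = J • volume :=
    ⟨_, Measure.addHaarScalarFactor_pos_of_isAddHaarMeasure _ _,
      Measure.isAddLeftInvariant_eq_smul _ _⟩
  refine ⟨J, hJ, fun H hH => ?_⟩
  have hmeas : Measurable fun x : Fin n → ℂ => ∏ k, H k (x k) :=
    Finset.measurable_prod _ fun k _ => (hH k).comp (measurable_pi_apply k)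
  rw [← lintegral_fin_prod_eq_prod hH, ← lintegral_map hmeas A.continuous.measurable,
    hmap, lintegral_smul_measure]
  simp [ENNReal.smul_def]

end ProductMeasure

section Bergman

open scoped ENNReal NNReal

variable {n : ℕ} {D : Set (Cn n)} {z X : Cn n}

lemma sq_norm_mul_measure_le_integral {P : Set (Cn n)} (hP : MeasurableSet P)
    (hbal : ∀ w ∈ P, ∀ l : ℂ, ‖l‖ ≤ 1 → l • w ∈ P) (hD : IsOpen D) {p : Cn n}
    (hPD : ∀ w ∈ P, p + w ∈ D) {f : Cn n → ℂ} (hf : DifferentiableOn ℂ f D)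
    (hf_int : IntegrableOn (fun w => ‖f w‖ ^ 2) D) :
    ‖f p‖ ^ 2 * volume.real P ≤ ∫ w in D, ‖f w‖ ^ 2 := by
  have h := sq_enorm_mul_measure_le_lintegral volume hP hbal hD hPD hf
  have hI : ∫⁻ w in D, ‖f w‖ₑ ^ 2 = ENNReal.ofReal (∫ w in D, ‖f w‖ ^ 2) := by
    rw [ofReal_integral_eq_lintegral_ofReal hf_int (ae_of_all _ fun w => by positivity)]
    refine lintegral_congr fun w => ?_
    rw [ENNReal.ofReal_pow (norm_nonneg _), ofReal_norm]
  rw [hI] at h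
  have h2 := ENNReal.toReal_mono ENNReal.ofReal_ne_top h
  rwa [ENNReal.toReal_ofReal (integral_nonneg fun w => by positivity), ENNReal.toReal_mul,
    ENNReal.toReal_pow, toReal_enorm] at h2

lemma bddAbove_bergmanKernel {P : Set (Cn n)} (hP : MeasurableSet P)
    (hbal : ∀ w ∈ P, ∀ l : ℂ, ‖l‖ ≤ 1 → l • w ∈ P) (hD : IsOpen D)
    (hPD : ∀ w ∈ P, z + w ∈ D) (hpos : 0 < volume.real P) :
    BddAbove {r : ℝ | ∃ f : Cn n → ℂ, DifferentiableOn ℂ f D ∧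
      IntegrableOn (fun w => ‖f w‖ ^ 2) D ∧ (∫ w in D, ‖f w‖ ^ 2) ≤ 1 ∧ r = ‖f z‖ ^ 2} := by
  refine ⟨(volume.real P)⁻¹, ?_⟩
  rintro _ ⟨f, hf, hf_int, hle, rfl⟩
  rw [← one_div, le_div_iff₀ hpos]
  exact (sq_norm_mul_measure_le_integral hP hbal hD hPD hf hf_int).trans hle

lemma bergmanM_mul_le {P : Set (Cn n)} (hP : MeasurableSet P)
    (hbal : ∀ w ∈ P, ∀ l : ℂ, ‖l‖ ≤ 1 → l • w ∈ P) (hD : IsOpen D) {r : ℝ} (hr : 0 < r)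
    (hX : ∀ l : ℂ, ‖l‖ < r → z + l • X ∈ D)
    (hPD : ∀ w ∈ P, ∀ l : ℂ, ‖l‖ ≤ r / 2 → z + l • X + w ∈ D) (hpos : 0 < volume.real P) :
    bergmanM D z X ≤ 2 / (r * √(volume.real P)) := by
  have hsq := Real.sqrt_pos.mpr hpos
  refine Real.sSup_le ?_ (by positivity)
  rintro _ ⟨f, hf, hf_int, hle, -, rfl⟩
  have hz : z ∈ D := by simpa using hX 0 (by simpa using hr)
  have hline : ∀ l : ℂ, HasDerivAt (fun l : ℂ => z + l • X) X l := fun l => by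
    simpa using ((hasDerivAt_id l).smul_const X).const_add z
  have hderiv : HasDerivAt (fun l : ℂ => f (z + l • X)) (fderiv ℂ f z X) 0 := by
    refine HasFDerivAt.comp_hasDerivAt (f := fun l : ℂ => z + l • X) 0 ?_ (hline 0)
    rw [zero_smul, add_zero]
    exact (hf.differentiableAt (hD.mem_nhds hz)).hasFDerivAt
  have hmaps : MapsTo (fun l : ℂ => z + l • X) (ball 0 r) D := fun l hl =>
    hX l (by simpa using hl)
  have hcl : closedBall (0 : ℂ) (r / 2) ⊆ ball 0 r := closedBall_subset_ball (by linarith)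
  have hdc : DiffContOnCl ℂ (fun l : ℂ => f (z + l • X)) (ball 0 (r / 2)) := by
    refine DifferentiableOn.diffContOnCl ?_
    rw [closure_ball _ (by positivity)]
    exact (hf.comp (fun l _ => (hline l).differentiableAt.differentiableWithinAt) hmaps).mono hcl
  have hbound : ∀ l ∈ sphere (0 : ℂ) (r / 2), ‖f (z + l • X)‖ ≤ 1 / √(volume.real P) := by
    intro l hl
    have h := sq_norm_mul_measure_le_integral (p := z + l • X) hP hbal hD
      (fun w hw => hPD w hw l (by simpa using hl.le)) hf hf_int
    rw [hle] at h
    rw [le_div_iff₀ hsq]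
    refine abs_le_of_sq_le_sq' ?_ zero_le_one |>.2
    rw [mul_pow, Real.sq_sqrt hpos.le]
    linarith
  have h := Complex.norm_deriv_le_of_forall_mem_sphere_norm_le (by positivity) hdc hbound
  rw [hderiv.deriv] at h
  refine h.trans_eq ?_
  field_simp

lemma le_bergmanKernel (hD : IsOpen D)
    (hbdd : BddAbove {r : ℝ | ∃ f : Cn n → ℂ, DifferentiableOn ℂ f D ∧
      IntegrableOn (fun w => ‖f w‖ ^ 2) D ∧ (∫ w in D, ‖f w‖ ^ 2) ≤ 1 ∧ r = ‖f z‖ ^ 2})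
    {F : Cn n → ℂ} (hF : DifferentiableOn ℂ F D) {N : ℝ} (hN : 0 < N)
    (hle : ∫⁻ w in D, ‖F w‖ₑ ^ 2 ≤ ENNReal.ofReal N) :
    ‖F z‖ ^ 2 / N ≤ bergmanKernel D z := by
  have hmeas : AEStronglyMeasurable F (volume.restrict D) :=
    hF.continuousOn.aestronglyMeasurable hD.measurableSet
  have hle' : ∫⁻ w in D, ENNReal.ofReal (‖F w‖ ^ 2) ≤ ENNReal.ofReal N := by
    refine le_of_eq_of_le (lintegral_congr fun w => ?_) hle
    rw [ENNReal.ofReal_pow (norm_nonneg _), ofReal_norm]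
  have hf_int : IntegrableOn (fun w => ‖F w‖ ^ 2) D := by
    refine ⟨hmeas.norm.pow 2, ?_⟩
    rw [hasFiniteIntegral_iff_ofReal (ae_of_all _ fun w => by positivity)]
    exact hle'.trans_lt ENNReal.ofReal_lt_top
  have hI : ∫ w in D, ‖F w‖ ^ 2 ≤ N := by
    rw [integral_eq_lintegral_of_nonneg_ae (ae_of_all _ fun w => sq_nonneg ‖F w‖) hf_int.1]
    exact ENNReal.toReal_le_of_le_ofReal hN.le hle'
  have hs : ∀ w, ‖((√N)⁻¹ : ℂ) * F w‖ ^ 2 = N⁻¹ * ‖F w‖ ^ 2 := by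
    intro w
    rw [norm_mul, mul_pow, norm_inv, Complex.norm_real, Real.norm_of_nonneg (Real.sqrt_nonneg _),
      inv_pow, Real.sq_sqrt hN.le]
  refine le_csSup hbdd ⟨fun w => ((√N)⁻¹ : ℂ) * F w, hF.const_mul _, ?_, ?_, ?_⟩
  · simp only [hs]
    exact hf_int.const_mul _
  · simp only [hs]
    rw [integral_const_mul, inv_mul_le_one₀ hN]
    exact hI
  · simp only [hs]
    ring

end Bergman

section Estimate

open scoped ENNReal NNReal

variable {n : ℕ} {D : Set (Cn n)} {z X : Cn n}

lemma LogConvex.exists_log_coordinate (hD : LogConvex D) (hDo : IsOpen D) (hz : z ∈ D)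
    (A : Cn n ≃L[ℂ] (Fin n → ℂ)) (k : Fin n) (hk : ∀ w ∈ D, A (w - z) k ≠ 1) :
    ∃ g : ℂ → ℂ, ContinuousOn g ((fun w => A (w - z) k) '' D) ∧
      ∀ ζ ∈ (fun w => A (w - z) k) '' D, exp (g ζ) = ζ - 1 := by
  let ℓ : Cn n →L[ℂ] ℂ := (ContinuousLinearMap.proj k).comp (A : Cn n →L[ℂ] (Fin n → ℂ))
  have hℓ : ∀ w, A (w - z) k = ℓ w - ℓ z := fun w => by simp [ℓ]
  obtain ⟨g, hg, hge⟩ := hD.exists_log_image hDo ⟨z, hz⟩ ℓ (v := A.symm (Pi.single k 1))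
    (by simp [ℓ]) (c := 1 + ℓ z) (fun w hw h => hk w hw (by rw [hℓ, h]; ring))
  have hmaps : ∀ ζ ∈ (fun w => A (w - z) k) '' D, ζ + ℓ z ∈ ℓ '' D := by
    rintro _ ⟨w, hw, rfl⟩
    exact ⟨w, hw, by simp [hℓ]⟩
  refine ⟨fun ζ => g (ζ + ℓ z), hg.comp (by fun_prop) hmaps, fun ζ hζ => ?_⟩
  rw [hge _ (hmaps ζ hζ)]
  ring

lemma isOpen_image_coordinate (hDo : IsOpen D) (A : Cn n ≃L[ℂ] (Fin n → ℂ)) (k : Fin n) :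
    IsOpen ((fun w => A (w - z) k) '' D) := by
  have : IsOpenMap fun w : Cn n => A (w - z) k :=
    (isOpenMap_eval k).comp (A.toHomeomorph.isOpenMap.comp (Homeomorph.subRight z).isOpenMap)
  exact this D hDo

lemma exists_holomorphic_lintegral_le (hD : LogConvex D) (hDo : IsOpen D) (hz : z ∈ D)
    {A : Cn n ≃L[ℂ] (Fin n → ℂ)} (hA : ∀ k, ∀ w ∈ D, A (w - z) k ≠ 1)
    (hdisc : ∀ k, ∀ l : ℂ, ‖l‖ < 1 → ∃ w ∈ D, A (w - z) k = l) {J : ℝ≥0}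
    (hJ : ∀ H : Fin n → ℂ → ℝ≥0∞, (∀ k, Measurable (H k)) →
      ∫⁻ w, ∏ k, H k (A w k) = J * ∏ k, ∫⁻ x, H k x) :
    ∃ F : Cn n → ℂ, DifferentiableOn ℂ F D ∧ ‖F z‖ = (1 / 8) ^ n ∧
      ∫⁻ w in D, ‖F w‖ₑ ^ 2 ≤ ENNReal.ofReal (J * (9 * Real.pi) ^ n) := by
  let G : Fin n → Set ℂ := fun k => (fun w => A (w - z) k) '' D
  have hG : ∀ k, IsOpen (G k) := fun k => isOpen_image_coordinate hDo A k
  have hex : ∀ k, ∃ h : ℂ → ℂ, DifferentiableOn ℂ h (G k) ∧ ‖h 0‖ = 1 / 8 ∧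
      ∫⁻ ζ in G k, ‖h ζ‖ₑ ^ 2 ≤ ENNReal.ofReal (9 * Real.pi) := by
    intro k
    obtain ⟨g, hg, hge⟩ := hD.exists_log_coordinate hDo hz A k (hA k)
    exact exists_holomorphic_of_log (hG k) (fun l hl => hdisc k l (by simpa using hl)) hg hge
  choose h hh hh0 h_le using hex
  let H : Fin n → ℂ → ℝ≥0∞ := fun k => (G k).indicator fun ζ => ‖h k ζ‖ₑ ^ 2
  have hH : ∀ k, Measurable (H k) := by
    classical
    intro k
    rw [show H k = (G k).piecewise (fun ζ => ‖h k ζ‖ₑ ^ 2) 0 from piecewise_eq_indicator.symm]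
    exact ContinuousOn.measurable_piecewise
      ((ENNReal.continuous_pow 2).comp_continuousOn (hh k).continuousOn.enorm)
      continuousOn_const (hG k).measurableSet
  refine ⟨fun w => ∏ k, h k (A (w - z) k), ?_, ?_, ?_⟩
  · have hA' : Differentiable ℂ fun w : Cn n => A (w - z) := by fun_prop
    have hk : ∀ k, DifferentiableOn ℂ (fun w => h k (A (w - z) k)) D := fun k =>
      (hh k).comp (f := fun w => A (w - z) k) (differentiable_pi.mp hA' k).differentiableOn
        fun w hw => mem_image_of_mem _ hw
    exact fun w hw => (HasFDerivWithinAt.finsetProd (u := Finset.univ)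
      (g := fun k w => h k (A (w - z) k))
      fun k _ => (hk k w hw).hasFDerivWithinAt).differentiableWithinAt
  · simp [norm_prod, hh0]
  · calc ∫⁻ w in D, ‖∏ k, h k (A (w - z) k)‖ₑ ^ 2
        = ∫⁻ w in D, ∏ k, H k (A (w - z) k) := by
          refine setLIntegral_congr_fun hDo.measurableSet fun w hw => ?_
          have : ∀ k, H k (A (w - z) k) = ‖h k (A (w - z) k)‖ₑ ^ 2 := fun k =>
            indicator_of_mem (mem_image_of_mem _ hw) _
          simp only [this, Finset.prod_pow, enorm_eq_nnnorm, nnnorm_prod,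
            ENNReal.ofNNReal_finsetProd]
      _ ≤ ∫⁻ w, ∏ k, H k (A (w - z) k) := setLIntegral_le_lintegral _ _
      _ = J * ∏ k, ∫⁻ x, H k x := by
          rw [← hJ H hH]
          exact lintegral_sub_right_eq_self (fun w => ∏ k, H k (A w k)) z
      _ ≤ J * ∏ _k : Fin n, ENNReal.ofReal (9 * Real.pi) := by
          gcongr with k
          rw [lintegral_indicator (hG k).measurableSet]
          exact h_le k
      _ = ENNReal.ofReal (J * (9 * Real.pi) ^ n) := by
          rw [ENNReal.ofReal_mul J.coe_nonneg, ENNReal.ofReal_pow (by positivity)]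
          simp

lemma measureReal_polydisc {A : Cn n ≃L[ℂ] (Fin n → ℂ)} {J : ℝ≥0}
    (hJ : ∀ H : Fin n → ℂ → ℝ≥0∞, (∀ k, Measurable (H k)) →
      ∫⁻ w, ∏ k, H k (A w k) = J * ∏ k, ∫⁻ x, H k x) {ρ : ℝ} (hρ : 0 ≤ ρ) :
    volume.real {w | ∀ k, ‖A w k‖ ≤ ρ} = J * (Real.pi * ρ ^ 2) ^ n := by
  have hP : IsClosed {w | ∀ k, ‖A w k‖ ≤ ρ} := by
    rw [ofPred_forall]
    exact isClosed_iInter fun k => isClosed_le (by fun_prop) continuous_const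
  have h := hJ (fun _ => (closedBall 0 ρ).indicator 1)
    fun _ => measurable_one.indicator measurableSet_closedBall
  have hl : ∀ w, ∏ k, (closedBall (0 : ℂ) ρ).indicator (1 : ℂ → ℝ≥0∞) (A w k) =
      {w | ∀ k, ‖A w k‖ ≤ ρ}.indicator 1 w := by
    classical
    intro w
    simp [indicator_apply, Finset.prod_ite_zero]
  simp only [hl, lintegral_indicator_one hP.measurableSet,
    lintegral_indicator_one measurableSet_closedBall, Complex.volume_closedBall] at h
  rw [measureReal_def, h]
  simp [hρ, mul_comm]

theorem bergmanMetric_mul_le (hD : LogConvex D) (hDo : IsOpen D) (hz : z ∈ D)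
    (hline : ∀ v : Cn n, v ≠ 0 → ∃ l : ℂ, z + l • v ∉ D) {r : ℝ} (hr : 0 < r)
    (hX : ∀ l : ℂ, ‖l‖ < r → z + l • X ∈ D) :
    bergmanMetric D z X * r ≤ 2 * (48 * (n + 1)) ^ n := by
  obtain ⟨A, hA, hdisc, hpoly⟩ := exists_adapted_coordinates (n := n) (by simp) hDo hz
    (fun a ha => hD.exists_forall_apply_ne hDo ⟨z, hz⟩ ha) hline
  obtain ⟨J, hJ0, hJ⟩ := exists_lintegral_prod_coordinates volume A
  set ρ : ℝ := 1 / (2 * (n + 1)) with hρ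
  have hρ0 : 0 < ρ := by positivity
  set P : Set (Cn n) := {w | ∀ k, ‖A w k‖ ≤ ρ} with hP
  have hPm : MeasurableSet P := by
    rw [hP, ofPred_forall]
    exact (isClosed_iInter fun k => isClosed_le (by fun_prop) continuous_const).measurableSet
  have hbal : ∀ w ∈ P, ∀ l : ℂ, ‖l‖ ≤ 1 → l • w ∈ P := by
    intro w hw l hl k
    rw [map_smul, Pi.smul_apply, norm_smul]
    exact (mul_le_of_le_one_left (norm_nonneg _) hl).trans (hw k)
  have hPD : ∀ w ∈ P, ∀ l : ℂ, ‖l‖ ≤ r / 2 → z + l • X + w ∈ D := hpoly X r hr hX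
  have hPv : volume.real P = J * (Real.pi * ρ ^ 2) ^ n := measureReal_polydisc hJ hρ0.le
  have hJ0' : (0 : ℝ) < J := hJ0
  have hpi := Real.pi_pos
  have hPpos : 0 < volume.real P := by
    rw [hPv]
    positivity
  obtain ⟨F, hF, hFz, hFint⟩ := exists_holomorphic_lintegral_le hD hDo hz hA hdisc hJ
  have hK := le_bergmanKernel hDo (bddAbove_bergmanKernel hPm hbal hDo
    (fun w hw => by simpa using hPD w hw 0 (by simpa using by positivity)) hPpos) hF
    (by positivity) hFint
  have hM := bergmanM_mul_le hPm hbal hDo hr hX hPD hPpos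
  set q : ℝ := (ρ / 24) ^ n with hq
  have hq0 : 0 < q := by positivity
  have hqK : q ^ 2 ≤ volume.real P * bergmanKernel D z := by
    refine le_trans (le_of_eq ?_) (mul_le_mul_of_nonneg_left hK hPpos.le)
    have h24 : ((ρ / 24) ^ n) ^ 2 * (9 * Real.pi) ^ n =
        (Real.pi * ρ ^ 2) ^ n * ((1 / 8) ^ n) ^ 2 := by
      rw [pow_right_comm (ρ / 24), pow_right_comm (1 / 8 : ℝ), ← mul_pow, ← mul_pow]
      congr 1
      ring
    rw [hFz, hPv, hq, ← mul_div_assoc, eq_div_iff (by positivity)]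
    linear_combination (J : ℝ) * h24
  have hK0 : 0 < bergmanKernel D z := by
    by_contra! h
    nlinarith [sq_pos_of_pos hq0]
  have hqs : q ≤ √(volume.real P) * √(bergmanKernel D z) := by
    rw [← Real.sqrt_mul hPpos.le]
    exact Real.le_sqrt_of_sq_le hqK
  have hsP := Real.sqrt_pos.mpr hPpos
  have hsK := Real.sqrt_pos.mpr hK0
  calc bergmanMetric D z X * r
      ≤ 2 / (r * √(volume.real P)) / √(bergmanKernel D z) * r := by
        rw [bergmanMetric]
        gcongr
    _ = 2 * (√(volume.real P) * √(bergmanKernel D z))⁻¹ := by field_simp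
    _ ≤ 2 * q⁻¹ := by gcongr
    _ = 2 * (48 * (n + 1)) ^ n := by
        rw [hq, hρ, ← inv_pow]
        congr 2
        field_simp
        norm_num

end Estimate

/-- There is `c_n > 0` such that for every ℂ-convex domain
`D ⊆ ℂⁿ` containing no complex line, `B_D(z;X)·d_D(z,X) ≤ c_n`. -/
theorem statement11 (n : ℕ) :
    ∃ c : ℝ, 0 < c ∧ ∀ D : Set (Cn n), IsDomain' D → IsCConvex D → NoComplexLine D →
      ∀ z ∈ D, ∀ X : Cn n, X ≠ 0 → bergmanMetric D z X * dirDist D z X ≤ c := by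
  refine ⟨2 * (48 * (n + 1)) ^ n, by positivity, fun D hD hconv hline z hz X _ => ?_⟩
  have hle : ∀ r : ℝ, 0 < r → (∀ l : ℂ, ‖l‖ < r → z + l • X ∈ D) →
      bergmanMetric D z X * r ≤ 2 * (48 * (n + 1)) ^ n := fun r hr hX =>
    bergmanMetric_mul_le (hconv.logConvex hD.1) hD.1 hz (fun v hv => by
      by_contra! h
      exact hline ⟨z, v, hv, by rintro _ ⟨l, rfl⟩; exact h l⟩) hr hX
  obtain hB | hB := le_or_gt (bergmanMetric D z X) 0
  · have h0 : 0 ≤ dirDist D z X := Real.sSup_nonneg fun r hr => hr.1.le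
    exact (mul_nonpos_of_nonpos_of_nonneg hB h0).trans (by positivity)
  · rw [mul_comm, ← le_div_iff₀ hB]
    refine Real.sSup_le (fun r hr => ?_) (by positivity)
    rw [le_div_iff₀ hB, mul_comm]
    exact hle r hr.1 hr.2

end
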